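/- Sparse regularity lemma with cleaning: For every ε, D > 0 and every positive integer t₀, there exist η > 0 and a positive integer T such that, for every d > 0 and every p ∈ [0,1], every graph G on n ≥ t₀ vertices which is (η,p,D)-upper-uniform contains a subgraph G' with e(G') ≥ e(G) − (D/t₀ + 2Dε + d)·p n²/2 that admits an equipartition V₁,…,V_t of its vertex set into t pieces with t₀ ≤ t ≤ T such that: (1) there are no edges of G' within V_i for any 1 ≤ i ≤ t, and (2) every non-empty bipartite graph G'(V_i,V_j) is (ε,p)-regular and has at least d p |V_i||V_j| edges. -/

import Mathlib

open Finset Filter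
open scoped Classical

/-- Number of ordered pairs `(x, y) ∈ X × Y` with `x` adjacent to `y` in `G`. -/
noncomputable def edgesBetween {V : Type} (G : SimpleGraph V) (X Y : Finset V) : ℕ :=
  ((X ×ˢ Y).filter fun pq => G.Adj pq.1 pq.2).card

/-- Edge density between `X` and `Y`. -/
noncomputable def density {V : Type} (G : SimpleGraph V) (X Y : Finset V) : ℝ :=
  (edgesBetween G X Y : ℝ) / ((X.card : ℝ) * (Y.card : ℝ))

/-- The pair `(A, B)` is `(ε, p)`-regular in `G`. -/
def IsRegularPair {V : Type} (G : SimpleGraph V) (A B : Finset V) (ε p : ℝ) : Prop :=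
  ∀ A' ⊆ A, ∀ B' ⊆ B, ε * A.card ≤ A'.card → ε * B.card ≤ B'.card →
    |density G A' B' - density G A B| ≤ ε * p

/-- The pair `(A, B)` is `(ε, d)`-lower-regular in `G`. -/
def IsLowerRegularPair {V : Type} (G : SimpleGraph V) (A B : Finset V) (ε d : ℝ) : Prop :=
  ∀ A' ⊆ A, ∀ B' ⊆ B, ε * A.card ≤ A'.card → ε * B.card ≤ B'.card →
    d ≤ density G A' B'

/-- Number of edges of `H` with both endpoints in `S`. -/
noncomputable def edgesWithin {V : Type} (H : SimpleGraph V) (S : Finset V) : ℕ :=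
  {e ∈ H.edgeSet | ∀ v ∈ e, v ∈ S}.ncard

/-- Number of edges of `H`. -/
noncomputable def edgeCount {V : Type} (H : SimpleGraph V) : ℕ := H.edgeSet.ncard

/-- The 2-density `m₂(H)`. -/
noncomputable def twoDensity {k : ℕ} (H : SimpleGraph (Fin k)) : ℝ :=
  max (1/2) (sSup {x : ℝ | ∃ S : Finset (Fin k), 3 ≤ S.card ∧
    x = ((edgesWithin H S : ℝ) - 1) / ((S.card : ℝ) - 2)})

/-- `H` is strictly balanced: every proper subgraph has strictly smaller 2-density. -/
def StrictlyBalanced {k : ℕ} (H : SimpleGraph (Fin k)) : Prop :=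
  ∀ H' : SimpleGraph (Fin k), H' ≤ H → H' ≠ H → twoDensity H' < twoDensity H

/-- `G` contains a copy of `H`. -/
def ContainsCopy {V W : Type} (H : SimpleGraph V) (G : SimpleGraph W) : Prop :=
  ∃ f : V → W, Function.Injective f ∧ ∀ a b, H.Adj a b → G.Adj (f a) (f b)

/-- Number of canonical copies of `H` in `G` w.r.t. the parts `P`. -/
noncomputable def canonicalCount {k : ℕ} {W : Type} (H : SimpleGraph (Fin k))
    (G : SimpleGraph W) (P : Fin k → Finset W) : ℕ :=
  {f : Fin k → W | (∀ i, f i ∈ P i) ∧ ∀ i j, H.Adj i j → G.Adj (f i) (f j)}.ncard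

/-- Probability that `G_{n,p}` satisfies the predicate `P`. -/
noncomputable def gnpProb (n : ℕ) (p : ℝ) (P : SimpleGraph (Fin n) → Prop) : ℝ :=
  ∑ G ∈ Finset.univ.filter P, p ^ edgeCount G * (1 - p) ^ (n.choose 2 - edgeCount G)

/-- Probability that the `p`-random subgraph `G_p` of `G` satisfies the predicate `P`. -/
noncomputable def subgraphProb {V : Type} [Fintype V] [DecidableEq V] (G : SimpleGraph V)
    (p : ℝ) (P : SimpleGraph V → Prop) : ℝ :=
  ∑ G' ∈ Finset.univ.filter (fun G' => G' ≤ G ∧ P G'),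
    p ^ edgeCount G' * (1 - p) ^ (edgeCount G - edgeCount G')

/-- The chromatic number of `H`, as a natural number. -/
noncomputable def chrom {k : ℕ} (H : SimpleGraph (Fin k)) : ℕ := H.chromaticNumber.toNat

/-- The edges of `H`, each represented once as an ordered pair `(i, j)` with `i < j`. -/
noncomputable def hPairs {k : ℕ} (H : SimpleGraph (Fin k)) : Finset (Fin k × Fin k) :=
  Finset.univ.filter fun ij => H.Adj ij.1 ij.2 ∧ ij.1 < ij.2

/-- Membership in `𝒢(H, n, m, p, ε)` (with parts `P`, inside ambient vertex type). -/
def InG {k N : ℕ} (H : SimpleGraph (Fin k)) (G : SimpleGraph (Fin N))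
    (P : Fin k → Finset (Fin N)) (n m : ℕ) (p ε : ℝ) : Prop :=
  (∀ i j, i ≠ j → Disjoint (P i) (P j)) ∧
  (∀ i, (P i).card = n) ∧
  (∀ u v, G.Adj u v → ∃ i j, H.Adj i j ∧ u ∈ P i ∧ v ∈ P j) ∧
  (∀ i j, H.Adj i j → IsRegularPair G (P i) (P j) ε p) ∧
  (∀ i j, H.Adj i j → edgesBetween G (P i) (P j) = m)

/-- Membership in `𝒢_ℓ(H, n, d, ε)` (lower-regular pairs, parts `P` covering the vertex set). -/
def InGl {k : ℕ} {W : Type} (H : SimpleGraph (Fin k)) (G : SimpleGraph W)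
    (P : Fin k → Finset W) (n : ℕ) (d ε : ℝ) : Prop :=
  (∀ i j, i ≠ j → Disjoint (P i) (P j)) ∧
  (∀ i, (P i).card = n) ∧
  (∀ v, ∃ i, v ∈ P i) ∧
  (∀ u v, G.Adj u v → ∃ i j, H.Adj i j ∧ u ∈ P i ∧ v ∈ P j) ∧
  (∀ i j, H.Adj i j → IsLowerRegularPair G (P i) (P j) ε d)

/-- `|𝒞(H,G;H',G')|`: canonical copies of `H` in `G` whose `H'`-edges lie in `G'`. -/
noncomputable def restrictedCount {k : ℕ} {W : Type} (H : SimpleGraph (Fin k))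
    (G : SimpleGraph W) (H' : SimpleGraph (Fin k)) (G' : SimpleGraph W)
    (P : Fin k → Finset W) : ℕ :=
  {f : Fin k → W | (∀ i, f i ∈ P i) ∧ (∀ i j, H.Adj i j → G.Adj (f i) (f j)) ∧
    (∀ i j, H'.Adj i j → G'.Adj (f i) (f j))}.ncard

/-- Number of copies of `H` in `G`, i.e. subgraphs of `G` isomorphic to `H`. -/
noncomputable def copyCount {k : ℕ} {W : Type} (H : SimpleGraph (Fin k))
    (G : SimpleGraph W) : ℕ :=
  {G' : G.Subgraph | Nonempty (G'.coe ≃g H)}.ncard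

/-- Number of `k`-cliques of `G`. -/
noncomputable def cliqueCount {V : Type} (k : ℕ) (G : SimpleGraph V) : ℕ :=
  {s : Finset V | G.IsNClique k s}.ncard

/-- `g_k(ρ, n)`: minimum number of `K_k`s in an `n`-vertex graph with at least `ρ·C(n,2)` edges. -/
noncomputable def gkn (k n : ℕ) (ρ : ℝ) : ℕ :=
  sInf {m : ℕ | ∃ G : SimpleGraph (Fin n),
    ρ * (n.choose 2 : ℝ) ≤ (edgeCount G : ℝ) ∧ cliqueCount k G = m}

/-- The clique density function `g_k(ρ) = lim_{n → ∞} g_k(ρ, n)/C(n,k)`. -/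
noncomputable def gk (k : ℕ) (ρ : ℝ) : ℝ :=
  limUnder atTop (fun n => (gkn k n ρ : ℝ) / (n.choose k : ℝ))

/-- `G` is `(η, p, D)`-upper-uniform. -/
def UpperUniform {V : Type} [Fintype V] (G : SimpleGraph V) (η p D : ℝ) : Prop :=
  ∀ U₁ U₂ : Finset V, Disjoint U₁ U₂ →
    η * (Fintype.card V : ℝ) ≤ U₁.card → η * (Fintype.card V : ℝ) ≤ U₂.card →
    density G U₁ U₂ ≤ D * p

/-- `G` is `(η, p, D)`-upper-uniform, also for edges inside a single set. -/
def UpperUniform' {V : Type} [Fintype V] (G : SimpleGraph V) (η p D : ℝ) : Prop :=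
  UpperUniform G η p D ∧
  ∀ U : Finset V, η * (Fintype.card V : ℝ) ≤ U.card →
    (edgesWithin G U : ℝ) ≤ D * p * (U.card.choose 2 : ℝ)

/-- `H` is a star forest. -/
def IsStarForest {V : Type} (H : SimpleGraph V) : Prop :=
  ∃ c : V → V, ∀ u v, H.Adj u v → c u = c v ∧ (c u = u ∨ c u = v)

/-- `G` is `(H, r)`-Ramsey. -/
def IsRamsey {k n : ℕ} (H : SimpleGraph (Fin k)) (r : ℕ) (G : SimpleGraph (Fin n)) : Prop :=
  ∀ col : Sym2 (Fin n) → Fin r, ∃ c : Fin r, ∃ f : Fin k → Fin n, Function.Injective f ∧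
    ∀ a b, H.Adj a b → G.Adj (f a) (f b) ∧ col s(f a, f b) = c

/-- `G` is `(H, ε)`-Turán. -/
def IsTuran {k n : ℕ} (H : SimpleGraph (Fin k)) (ε : ℝ) (G : SimpleGraph (Fin n)) : Prop :=
  ∀ G' : SimpleGraph (Fin n), G' ≤ G →
    (1 - 1 / ((chrom H : ℝ) - 1) + ε) * (edgeCount G : ℝ) ≤ (edgeCount G' : ℝ) →
    ContainsCopy H G'

/-- The normalized homomorphism count `μ_H(G)`. -/
noncomputable def muH {k N : ℕ} (H : SimpleGraph (Fin k)) (G : SimpleGraph (Fin N)) : ℝ :=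
  (∑ f : Fin k → Fin N, ∏ ij ∈ hPairs H, (if G.Adj (f ij.1) (f ij.2) then (1:ℝ) else 0))
    / (N : ℝ) ^ k

/-- Membership in `H*(V₁, …, V_k)`: all edges lie between pairs `Vᵢ, Vⱼ` with `ij ∈ E(H)`. -/
def InHstar {k N : ℕ} (H : SimpleGraph (Fin k)) (G : SimpleGraph (Fin N))
    (P : Fin k → Finset (Fin N)) : Prop :=
  ∀ u v, G.Adj u v → ∃ i j, H.Adj i j ∧ u ∈ P i ∧ v ∈ P j

/-- The normalized canonical homomorphism count `μ*_H(G)`. -/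
noncomputable def muHstar {k N : ℕ} (H : SimpleGraph (Fin k)) (G : SimpleGraph (Fin N))
    (P : Fin k → Finset (Fin N)) : ℝ :=
  (∑ f ∈ Finset.univ.filter (fun f : Fin k → Fin N => ∀ i, f i ∈ P i),
    ∏ ij ∈ hPairs H, (if G.Adj (f ij.1) (f ij.2) then (1:ℝ) else 0)) / (N : ℝ) ^ k

/-- Real-valued adjacency indicator. -/
noncomputable def adjR {V : Type} (G : SimpleGraph V) (x y : V) : ℝ := if G.Adj x y then 1 else 0

lemma edgesBetween_eq_sum {V : Type} (G : SimpleGraph V) (X Y : Finset V) :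
    (edgesBetween G X Y : ℝ) = ∑ x ∈ X, ∑ y ∈ Y, adjR G x y := by
  unfold edgesBetween adjR
  rw [Finset.card_filter, Finset.sum_product]
  push_cast
  rfl

lemma adjR_comm {V : Type} (G : SimpleGraph V) (x y : V) : adjR G x y = adjR G y x := by
  unfold adjR
  simp [G.adj_comm]

lemma edgesBetween_comm {V : Type} (G : SimpleGraph V) (X Y : Finset V) :
    edgesBetween G X Y = edgesBetween G Y X := by
  have : (edgesBetween G X Y : ℝ) = edgesBetween G Y X := by
    rw [edgesBetween_eq_sum, edgesBetween_eq_sum, Finset.sum_comm]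
    simp only [adjR_comm]
  exact_mod_cast this

lemma density_comm {V : Type} (G : SimpleGraph V) (X Y : Finset V) :
    density G X Y = density G Y X := by
  unfold density
  rw [edgesBetween_comm, mul_comm]

lemma IsRegularPair.symm' {V : Type} {G : SimpleGraph V} {A B : Finset V} {ε p : ℝ}
    (h : IsRegularPair G A B ε p) : IsRegularPair G B A ε p := by
  intro A' hA B' hB h1 h2
  rw [density_comm G A' B', density_comm G B A]
  exact h B' hB A' hA h2 h1

lemma edgesBetween_le {V : Type} (G : SimpleGraph V) (X Y : Finset V) :
    edgesBetween G X Y ≤ X.card * Y.card := by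
  unfold edgesBetween
  rw [← Finset.card_product]
  exact Finset.card_filter_le _ _

lemma density_mul {V : Type} (G : SimpleGraph V) (X Y : Finset V) :
    density G X Y * ((X.card : ℝ) * Y.card) = edgesBetween G X Y := by
  unfold density
  by_cases h : ((X.card : ℝ) * Y.card) = 0
  · have h1 : X.card * Y.card = 0 := by exact_mod_cast h
    have h2 := edgesBetween_le G X Y
    have h3 : edgesBetween G X Y = 0 := by omega
    simp [h3]
  · exact div_mul_cancel₀ _ h

lemma density_nonneg {V : Type} (G : SimpleGraph V) (X Y : Finset V) : 0 ≤ density G X Y := by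
  unfold density; positivity

lemma edgesBetween_univ {V : Type} [Fintype V] (H : SimpleGraph V) :
    edgesBetween H univ univ = 2 * edgeCount H := by
  have h := H.sum_degrees_eq_twice_card_edges
  unfold edgeCount
  rw [Set.ncard_eq_toFinset_card', ← SimpleGraph.edgeFinset]
  rw [← h]
  unfold edgesBetween
  rw [Finset.card_filter, Finset.sum_product]
  refine Finset.sum_congr rfl fun x _ => ?_
  rw [← Finset.card_filter, ← SimpleGraph.card_neighborFinset_eq_degree]
  congr 1
  ext y
  simp

lemma edgesBetween_self {V : Type} [Fintype V] (G : SimpleGraph V) (S : Finset V) :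
    edgesBetween G S S = 2 * edgesWithin G S := by
  let H : SimpleGraph V :=
    { Adj := fun x y => G.Adj x y ∧ x ∈ S ∧ y ∈ S
      symm := ⟨fun x y h => ⟨h.1.symm, h.2.2, h.2.1⟩⟩
      loopless := ⟨fun x h => G.loopless.irrefl x h.1⟩ }
  have h := edgesBetween_univ H
  have h1 : edgesBetween H univ univ = edgesBetween G S S := by
    unfold edgesBetween
    congr 1
    ext ⟨x, y⟩
    simp [H]
    tauto
  have h2 : edgeCount H = edgesWithin G S := by
    unfold edgeCount edgesWithin
    congr 1
    ext e
    induction e with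
    | _ x y => simp [H]
  rw [← h1, h, h2]

/-- Sorted block partition. -/
lemma exists_blocks {V : Type} [Fintype V] [Nonempty V] (K t : ℕ) (ht : 0 < t) (c : V → Fin K) :
    ∃ q : V → Fin t,
      (∀ i, ((univ.filter fun v => q v = i).card : ℤ) * t < Fintype.card V + t) ∧
      (∀ i, (Fintype.card V : ℤ) < (((univ.filter fun v => q v = i).card : ℤ) + 1) * t) ∧
      (univ.filter fun i : Fin t => ¬ ∃ a, ∀ v, q v = i → c v = a).card ≤ K := by
  set n := Fintype.card V with hn
  let e0 : V ≃ Fin n := Fintype.equivFin V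
  let f : Fin n → Fin K := fun r => c (e0.symm r)
  let e : V ≃ Fin n := e0.trans (Tuple.sort f).symm
  have hmono : Monotone (fun r => c (e.symm r)) := Tuple.monotone_sort f
  have hlt : ∀ v, (e v : ℕ) * t / n < t := by
    intro v
    have h1 : (e v : ℕ) < n := (e v).2
    rw [Nat.div_lt_iff_lt_mul (by omega)]
    nlinarith
  let q : V → Fin t := fun v => ⟨(e v : ℕ) * t / n, hlt v⟩
  have hqm : ∀ u v, q u < q v → e u < e v := by
    intro u v h
    by_contra hc
    push Not at hc
    have : q v ≤ q u := by
      change (e v : ℕ) * t / n ≤ (e u : ℕ) * t / n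
      exact Nat.div_le_div_right (Nat.mul_le_mul_right _ hc)
    exact absurd h (not_lt.mpr this)
  have hcm : ∀ u v, e u ≤ e v → c u ≤ c v := by
    intro u v h
    simpa using hmono h
  have hcard : ∀ i : Fin t, (univ.filter fun v => q v = i).card =
      ((((i : ℕ) + 1) * n + (t - 1)) / t) - (((i : ℕ) * n + (t - 1)) / t) := by
    intro i
    rw [← Nat.card_Ico]
    refine Finset.card_bij (fun v _ => (e v : ℕ)) ?_ ?_ ?_
    · intro v hv
      simp only [mem_filter, mem_univ, true_and] at hv
      have h1 : (e v : ℕ) * t / n = i := congrArg Fin.val hv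
      have hnpos : 0 < n := (Nat.zero_le _).trans_lt (e v).2
      rw [Nat.div_eq_iff hnpos] at h1
      simp only [Finset.mem_Ico]
      constructor
      · rw [← Nat.lt_succ_iff, Nat.div_lt_iff_lt_mul ht]
        have : ((e v : ℕ) + 1) * t = (e v : ℕ) * t + t := by ring
        have h2 := h1.1
        simp only [Nat.succ_eq_add_one]
        omega
      · rw [← Nat.succ_le_iff, Nat.le_div_iff_mul_le ht]
        have : ((e v : ℕ) + 1) * t = (e v : ℕ) * t + t := by ring
        have : ((i : ℕ) + 1) * n = (i : ℕ) * n + n := by ring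
        have h2 := h1.2
        simp only [Nat.succ_eq_add_one]
        omega
    · intro u _ v _ h
      exact e.injective (Fin.ext h)
    · intro r hr
      simp only [Finset.mem_Ico] at hr
      obtain ⟨h1, h2⟩ := hr
      rw [← Nat.lt_succ_iff, Nat.div_lt_iff_lt_mul ht] at h1
      rw [← Nat.succ_le_iff, Nat.le_div_iff_mul_le ht] at h2
      simp only [Nat.succ_eq_add_one] at h1 h2
      have e1 : (r + 1) * t = r * t + t := by ring
      have e2 : ((i : ℕ) + 1) * n = (i : ℕ) * n + n := by ring
      have hit : ((i : ℕ) + 1) * n ≤ t * n := Nat.mul_le_mul_right _ i.2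
      have hrn : r < n := by
        have : r * t < n * t := by rw [mul_comm n t]; omega
        exact lt_of_mul_lt_mul_right this (Nat.zero_le _)
      refine ⟨e.symm ⟨r, hrn⟩, ?_, ?_⟩
      · simp only [mem_filter, mem_univ, true_and]
        apply Fin.ext
        simp only [q, Equiv.apply_symm_apply]
        rw [Nat.div_eq_iff (by omega)]
        omega
      · simp
  refine ⟨q, ?_, ?_, ?_⟩
  · intro i
    rw [hcard]
    set a := ((i : ℕ) * n + (t - 1)) / t with ha
    set b := (((i : ℕ) + 1) * n + (t - 1)) / t with hb
    have ha1 : ((i : ℕ) * n + (t - 1)) < (a + 1) * t := by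
      rw [← Nat.div_lt_iff_lt_mul ht]; omega
    have hb1 : b * t ≤ ((i : ℕ) + 1) * n + (t - 1) := Nat.div_mul_le_self _ _
    have e1 : (a + 1) * t = a * t + t := by ring
    have e2 : ((i : ℕ) + 1) * n = (i : ℕ) * n + n := by ring
    have hab : a ≤ b := Nat.div_le_div_right (by omega)
    push_cast [Nat.cast_sub hab]
    rw [sub_mul]
    have : ((b * t : ℕ) : ℤ) < a * t + (n + t) := by push_cast; zify at *; omega
    push_cast at this
    linarith
  · intro i
    rw [hcard]
    set a := ((i : ℕ) * n + (t - 1)) / t with ha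
    set b := (((i : ℕ) + 1) * n + (t - 1)) / t with hb
    have hb1 : (((i : ℕ) + 1) * n + (t - 1)) < (b + 1) * t := by
      rw [← Nat.div_lt_iff_lt_mul ht]; omega
    have ha1 : a * t ≤ (i : ℕ) * n + (t - 1) := Nat.div_mul_le_self _ _
    have e1 : (b + 1) * t = b * t + t := by ring
    have e2 : ((i : ℕ) + 1) * n = (i : ℕ) * n + n := by ring
    have hab : a ≤ b := Nat.div_le_div_right (by omega)
    push_cast [Nat.cast_sub hab]
    have : ((n + a * t : ℕ) : ℤ) < b * t + t := by
      have : n + a * t < b * t + t := by omega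
      exact_mod_cast this
    push_cast at this
    linarith
  · have key : ∀ i ∈ univ.filter (fun i : Fin t => ¬ ∃ a, ∀ v, q v = i → c v = a),
        ∃ u v, q u = i ∧ q v = i ∧ c u < c v := by
      intro i hi
      simp only [mem_filter, mem_univ, true_and] at hi
      by_contra hc
      push Not at hc
      apply hi
      by_cases hne : ∃ v, q v = i
      · obtain ⟨v, hv⟩ := hne
        exact ⟨c v, fun u hu => le_antisymm (hc v u hv hu) (hc u v hu hv)⟩
      · push Not at hne
        obtain ⟨v⟩ := (inferInstance : Nonempty V)
        exact ⟨c v, fun u hu => absurd hu (hne u)⟩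
    choose! lo hi h1 h2 h3 using key
    have := Finset.card_le_card_of_injOn (s := univ.filter
      (fun i : Fin t => ¬ ∃ a, ∀ v, q v = i → c v = a)) (t := (univ : Finset (Fin K)))
      (fun i => c (hi i)) (fun _ _ => Finset.mem_coe.mpr (mem_univ _)) ?_
    · simpa using this
    · have main : ∀ i ∈ univ.filter (fun i : Fin t => ¬ ∃ a, ∀ v, q v = i → c v = a),
          ∀ j ∈ univ.filter (fun i : Fin t => ¬ ∃ a, ∀ v, q v = i → c v = a), i < j →
          c (hi i) < c (hi j) := by
        intro i hi' j hj' hij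
        refine lt_of_le_of_lt (hcm _ (lo j) (hqm _ _ ?_).le) (h3 j hj')
        rw [h2 i hi', h1 j hj']; exact hij
      intro i hi' j hj' hEq
      rcases lt_trichotomy i j with h | h | h
      · exact absurd hEq (main i hi' j hj' h).ne
      · exact h
      · exact absurd hEq (main j hj' i hi' h).ne'

/-- The dual energy functional. -/
noncomputable def energyJ {V : Type} [Fintype V] (G : SimpleGraph V) (s : V → V → ℝ) : ℝ :=
  ∑ x, ∑ y, (2 * adjR G x y * s x y - s x y ^ 2)

/-- There is a bounded step function with at most `K` colours and energy at least `e`. -/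
def EnergyState {V : Type} [Fintype V] (G : SimpleGraph V) (L : ℝ) (K : ℕ) (e : ℝ) : Prop :=
  ∃ (c : V → Fin K) (g : Fin K → Fin K → ℝ), (∀ a b, 0 ≤ g a b ∧ g a b ≤ L) ∧
    e ≤ energyJ G (fun x y => g (c x) (c y))

lemma sum_ite_sub {V : Type} (U W U' W' : Finset V) (hU : U' ⊆ U) (hW : W' ⊆ W)
    (F : V → V → ℝ) :
    ∑ x ∈ U, ∑ y ∈ W, (if x ∈ U' ∧ y ∈ W' then F x y else 0) = ∑ x ∈ U', ∑ y ∈ W', F x y := by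
  rw [← Finset.sum_subset hU]
  · refine Finset.sum_congr rfl fun x hx => ?_
    rw [← Finset.sum_subset hW]
    · refine Finset.sum_congr rfl fun y hy => ?_
      simp [hx, hy]
    · intro y _ hy
      simp [hy]
  · intro x _ hx
    simp [hx]

lemma block_const {V : Type} (G : SimpleGraph V) (U W : Finset V) (b : ℝ) :
    ∑ x ∈ U, ∑ y ∈ W, (2 * adjR G x y * b - b ^ 2) =
      2 * edgesBetween G U W * b - b ^ 2 * (U.card * W.card) := by
  rw [edgesBetween_eq_sum]
  simp only [Finset.sum_sub_distrib, Finset.mul_sum, Finset.sum_mul, Finset.sum_const,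
    nsmul_eq_mul]
  ring

lemma block_gain {V : Type} (G : SimpleGraph V) (U W U' W' : Finset V) (hU : U' ⊆ U)
    (hW : W' ⊆ W) (a : ℝ) :
    ∑ x ∈ U, ∑ y ∈ W, (2 * adjR G x y * a - a ^ 2) +
      (U'.card * W'.card : ℝ) * (density G U' W' - density G U W) ^ 2 ≤
    ∑ x ∈ U, ∑ y ∈ W, (2 * adjR G x y *
      (if x ∈ U' ∧ y ∈ W' then density G U' W' else density G U W) -
      (if x ∈ U' ∧ y ∈ W' then density G U' W' else density G U W) ^ 2) := by
  set y0 := density G U' W' with hy0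
  set x0 := density G U W with hx0
  have h1 : ∑ x ∈ U, ∑ y ∈ W, (2 * adjR G x y * (if x ∈ U' ∧ y ∈ W' then y0 else x0) -
      (if x ∈ U' ∧ y ∈ W' then y0 else x0) ^ 2) =
      ∑ x ∈ U, ∑ y ∈ W, (2 * adjR G x y * x0 - x0 ^ 2) +
      (∑ x ∈ U', ∑ y ∈ W', (2 * adjR G x y * y0 - y0 ^ 2) -
       ∑ x ∈ U', ∑ y ∈ W', (2 * adjR G x y * x0 - x0 ^ 2)) := by
    simp only [← Finset.sum_sub_distrib]
    rw [← sum_ite_sub U W U' W' hU hW]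
    simp only [← Finset.sum_add_distrib]
    refine Finset.sum_congr rfl fun x _ => Finset.sum_congr rfl fun y _ => ?_
    split_ifs <;> ring
  rw [h1]
  simp only [block_const]
  have e1 := density_mul G U W
  have e2 := density_mul G U' W'
  rw [← hx0] at e1
  rw [← hy0] at e2
  rw [← e1, ← e2]
  have : 0 ≤ (U.card * W.card : ℝ) * (x0 - a) ^ 2 := by positivity
  nlinarith

/-- Fibres of a labelling. -/
noncomputable def fib {V : Type} [Fintype V] {t : ℕ} (q : V → Fin t) (i : Fin t) : Finset V :=
  univ.filter fun v => q v = i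

lemma mem_fib {V : Type} [Fintype V] {t : ℕ} (q : V → Fin t) (i : Fin t) (v : V) :
    v ∈ fib q i ↔ q v = i := by simp [fib]

lemma sum_blocks {V : Type} [Fintype V] {t : ℕ} (q : V → Fin t) (F : V → V → ℝ) :
    ∑ x, ∑ y, F x y = ∑ i, ∑ j, ∑ x ∈ fib q i, ∑ y ∈ fib q j, F x y := by
  have h1 : ∀ f : V → ℝ, ∑ x, f x = ∑ i, ∑ x ∈ fib q i, f x := fun f =>
    (Finset.sum_fiberwise univ q f).symm
  rw [h1]
  refine Finset.sum_congr rfl fun i _ => ?_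
  rw [Finset.sum_comm (s := (univ : Finset (Fin t)))]
  refine Finset.sum_congr rfl fun x _ => ?_
  exact h1 _

/-- `q` is balanced. -/
def BalLab {V : Type} [Fintype V] {t : ℕ} (q : V → Fin t) : Prop :=
  (∀ i, ((fib q i).card : ℤ) * t < Fintype.card V + t) ∧
  (∀ i, (Fintype.card V : ℤ) < (((fib q i).card : ℤ) + 1) * t)

/-- Irregular ordered pairs. -/
noncomputable def irr {V : Type} [Fintype V] {t : ℕ} (G : SimpleGraph V) (q : V → Fin t)
    (ε p : ℝ) : Finset (Fin t × Fin t) :=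
  univ.filter fun ij => ij.1 ≠ ij.2 ∧ ¬ IsRegularPair G (fib q ij.1) (fib q ij.2) ε p

lemma mem_irr {V : Type} [Fintype V] {t : ℕ} (G : SimpleGraph V) (q : V → Fin t)
    (ε p : ℝ) (i j : Fin t) : (i, j) ∈ irr G q ε p ↔
      i ≠ j ∧ ¬ IsRegularPair G (fib q i) (fib q j) ε p := by
  simp [irr]

lemma BalLab.lower {V : Type} [Fintype V] {t : ℕ} {q : V → Fin t} (h : BalLab q)
    (ht : 0 < t) (hn : t ≤ Fintype.card V) (i : Fin t) :
    (Fintype.card V : ℝ) / (2 * t) ≤ (fib q i).card := by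
  have h2 := h.2 i
  have ht' : (0 : ℤ) < t := by exact_mod_cast ht
  have hn' : (t : ℤ) ≤ Fintype.card V := by exact_mod_cast hn
  have h3 : (1 : ℤ) ≤ (fib q i).card := by
    by_contra hc
    have : ((fib q i).card : ℤ) = 0 := by omega
    rw [this] at h2
    linarith
  have h4 : (Fintype.card V : ℤ) ≤ (fib q i).card * (2 * t) := by nlinarith
  rw [div_le_iff₀ (by positivity)]
  exact_mod_cast h4

lemma BalLab.upper {V : Type} [Fintype V] {t : ℕ} {q : V → Fin t} (h : BalLab q)
    (ht : 0 < t) (hn : t ≤ Fintype.card V) (i : Fin t) :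
    ((fib q i).card : ℝ) ≤ 2 * Fintype.card V / t := by
  have h2 := h.1 i
  have hn' : (t : ℤ) ≤ Fintype.card V := by exact_mod_cast hn
  have h4 : ((fib q i).card : ℤ) * t ≤ 2 * Fintype.card V := by linarith
  rw [le_div_iff₀ (by positivity)]
  exact_mod_cast h4

lemma step {V : Type} [Fintype V] [Nonempty V] (G : SimpleGraph V) (ε D p η : ℝ) (K t : ℕ)
    (hε : 0 < ε) (hD : 0 < D) (hp : 0 < p) (ht : 0 < t) (htn : t ≤ Fintype.card V)
    (hη : η * (2 * t) ≤ ε) (hη' : η * (2 * t) ≤ 1) (hK : 8 * (K : ℝ) ≤ ε * t)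
    (hG : UpperUniform G η p D) (e : ℝ) (hS : EnergyState G (D * p) K e) :
    (∃ q : V → Fin t, BalLab q ∧ ((irr G q ε p).card : ℝ) ≤ ε / 2 * (t : ℝ) ^ 2) ∨
    EnergyState G (D * p) (K * (t * (2 ^ t * 2 ^ t)))
      (e + ε ^ 5 / 16 * p ^ 2 * (Fintype.card V : ℝ) ^ 2) := by
  obtain ⟨c, g, hg, he⟩ := hS
  obtain ⟨q, hq1, hq2, hq3⟩ := exists_blocks K t ht c
  have hbal : BalLab q := ⟨hq1, hq2⟩
  by_cases hgood : ((irr G q ε p).card : ℝ) ≤ ε / 2 * (t : ℝ) ^ 2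
  · exact Or.inl ⟨q, hbal, hgood⟩
  right
  push Not at hgood
  set n : ℝ := (Fintype.card V : ℝ) with hn
  have hnpos : 0 < n := by rw [hn]; exact_mod_cast Fintype.card_pos
  have htR : (0 : ℝ) < t := by exact_mod_cast ht
  have hlow := hbal.lower ht htn
  let mono : Fin t → Prop := fun i => ∃ a, ∀ v, q v = i → c v = a
  let Bad : Fin t → Fin t → Prop := fun i j => (i, j) ∈ irr G q ε p ∧ mono i ∧ mono j
  -- count of bad pairs
  have hcount : ε / 4 * (t : ℝ) ^ 2 ≤
      ((univ.filter fun ij : Fin t × Fin t => Bad ij.1 ij.2).card : ℝ) := by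
    set NM := univ.filter (fun i : Fin t => ¬ mono i) with hNM
    have hsub : irr G q ε p ⊆ (univ.filter fun ij : Fin t × Fin t => Bad ij.1 ij.2) ∪
        (NM ×ˢ univ ∪ univ ×ˢ NM) := by
      intro ij hij
      simp only [mem_union, mem_filter, mem_univ, true_and, mem_product, and_true, hNM, Bad]
      tauto
    have h1 := (Finset.card_le_card hsub).trans (Finset.card_union_le _ _)
    have h2 := Finset.card_union_le (NM ×ˢ (univ : Finset (Fin t))) (univ ×ˢ NM)
    simp only [Finset.card_product, Finset.card_univ, Fintype.card_fin] at h2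
    have h3 : NM.card ≤ K := hq3
    have h4 : (irr G q ε p).card ≤
        (univ.filter fun ij : Fin t × Fin t => Bad ij.1 ij.2).card + (K * t + t * K) := by
      have := Nat.mul_le_mul_right t h3
      have := Nat.mul_le_mul_left t h3
      omega
    have h5 : ((irr G q ε p).card : ℝ) ≤
        (univ.filter fun ij : Fin t × Fin t => Bad ij.1 ij.2).card + (K * t + t * K) := by
      exact_mod_cast h4
    nlinarith
  -- witnesses
  have hwit : ∀ i j, ∃ A B : Finset V, A ⊆ fib q i ∧ B ⊆ fib q j ∧ (Bad i j →
      ε * (fib q i).card ≤ A.card ∧ ε * (fib q j).card ≤ B.card ∧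
      ε * p < |density G A B - density G (fib q i) (fib q j)|) := by
    intro i j
    by_cases hb : Bad i j
    · have h1 := hb.1
      rw [mem_irr] at h1
      obtain ⟨_, h2⟩ := h1
      unfold IsRegularPair at h2
      push Not at h2
      obtain ⟨A, hA, B, hB, h3, h4, h5⟩ := h2
      exact ⟨A, B, hA, hB, fun _ => ⟨h3, h4, h5⟩⟩
    · exact ⟨∅, ∅, by simp, by simp, fun h => absurd h hb⟩
  choose A B hA hB hAB using hwit
  have hηpart : ∀ i, η * n ≤ (fib q i).card := by
    intro i
    refine le_trans ?_ (hlow i)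
    rw [le_div_iff₀ (by positivity)]
    nlinarith
  have hεpart : ∀ i, η * n ≤ ε * (fib q i).card := by
    intro i
    refine le_trans ?_ (mul_le_mul_of_nonneg_left (hlow i) hε.le)
    rw [mul_div_assoc', le_div_iff₀ (by positivity)]
    nlinarith
  have hdisj : ∀ i j, Bad i j → Disjoint (fib q i) (fib q j) := by
    intro i j hb
    have h1 := hb.1
    rw [mem_irr] at h1
    rw [Finset.disjoint_left]
    intro v hv hv'
    rw [mem_fib] at hv hv'
    exact h1.1 (hv.symm.trans hv')
  have hx : ∀ i j, Bad i j → density G (fib q i) (fib q j) ≤ D * p := fun i j hb =>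
    hG _ _ (hdisj i j hb) (hηpart i) (hηpart j)
  have hy : ∀ i j, Bad i j → density G (A i j) (B i j) ≤ D * p := fun i j hb =>
    hG _ _ ((hdisj i j hb).mono (hA i j) (hB i j)) ((hεpart i).trans (hAB i j hb).1)
      ((hεpart j).trans (hAB i j hb).2.1)
  -- new colouring
  let C := Fin K × Fin t × (Fin t → Bool) × (Fin t → Bool)
  let c' : V → C := fun v =>
    (c v, q v, fun j => decide (v ∈ A (q v) j), fun i => decide (v ∈ B i (q v)))
  let g' : C → C → ℝ := fun a b =>
    if Bad a.2.1 b.2.1 then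
      (if a.2.2.1 b.2.1 = true ∧ b.2.2.2 a.2.1 = true then density G (A a.2.1 b.2.1) (B a.2.1 b.2.1)
        else density G (fib q a.2.1) (fib q b.2.1))
    else g a.1 b.1
  have hg' : ∀ a b, 0 ≤ g' a b ∧ g' a b ≤ D * p := by
    intro a b
    simp only [g']
    split_ifs with h1 h2
    · exact ⟨density_nonneg _ _ _, hy _ _ h1⟩
    · exact ⟨density_nonneg _ _ _, hx _ _ h1⟩
    · exact hg _ _
  have hcardC : Fintype.card C = K * (t * (2 ^ t * 2 ^ t)) := by
    simp [C]
  let φ : C ≃ Fin (K * (t * (2 ^ t * 2 ^ t))) := Fintype.equivFinOfCardEq hcardC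
  refine ⟨fun v => φ (c' v), fun a b => g' (φ.symm a) (φ.symm b), fun a b => hg' _ _, ?_⟩
  simp only [Equiv.symm_apply_apply]
  have hblock : ∀ i j,
      ∑ x ∈ fib q i, ∑ y ∈ fib q j, (2 * adjR G x y * g (c x) (c y) - g (c x) (c y) ^ 2) +
        (if Bad i j then ε ^ 4 * p ^ 2 * n ^ 2 / (4 * t ^ 2) else 0) ≤
      ∑ x ∈ fib q i, ∑ y ∈ fib q j,
        (2 * adjR G x y * g' (c' x) (c' y) - g' (c' x) (c' y) ^ 2) := by
    intro i j
    by_cases hb : Bad i j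
    · obtain ⟨a, ha⟩ := hb.2.1
      obtain ⟨b, hb'⟩ := hb.2.2
      have h1 := block_gain G (fib q i) (fib q j) (A i j) (B i j) (hA i j) (hB i j) (g a b)
      obtain ⟨w1, w2, w3⟩ := hAB i j hb
      have h2 : ε ^ 4 * p ^ 2 * n ^ 2 / (4 * t ^ 2) ≤ ((A i j).card * (B i j).card : ℝ) *
          (density G (A i j) (B i j) - density G (fib q i) (fib q j)) ^ 2 := by
        have k1 : ε * (n / (2 * t)) ≤ (A i j).card :=
          (mul_le_mul_of_nonneg_left (hlow i) hε.le).trans w1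
        have k2 : ε * (n / (2 * t)) ≤ (B i j).card :=
          (mul_le_mul_of_nonneg_left (hlow j) hε.le).trans w2
        have k3 : (ε * p) ^ 2 ≤
            (density G (A i j) (B i j) - density G (fib q i) (fib q j)) ^ 2 := by
          rw [← sq_abs (density G (A i j) (B i j) - density G (fib q i) (fib q j))]
          exact pow_le_pow_left₀ (by positivity) w3.le 2
        have k0 : 0 ≤ ε * (n / (2 * t)) := by positivity
        calc ε ^ 4 * p ^ 2 * n ^ 2 / (4 * t ^ 2)
            = (ε * (n / (2 * t))) * (ε * (n / (2 * t))) * (ε * p) ^ 2 := by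
              field_simp; ring
          _ ≤ _ := mul_le_mul (mul_le_mul k1 k2 k0 (by positivity)) k3 (by positivity)
              (by positivity)
      rw [if_pos hb]
      have e1 : ∑ x ∈ fib q i, ∑ y ∈ fib q j,
          (2 * adjR G x y * g (c x) (c y) - g (c x) (c y) ^ 2) =
          ∑ x ∈ fib q i, ∑ y ∈ fib q j, (2 * adjR G x y * g a b - g a b ^ 2) := by
        refine Finset.sum_congr rfl fun x hx => Finset.sum_congr rfl fun y hy => ?_
        rw [mem_fib] at hx hy
        rw [ha x hx, hb' y hy]
      have e2 : ∑ x ∈ fib q i, ∑ y ∈ fib q j,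
          (2 * adjR G x y * g' (c' x) (c' y) - g' (c' x) (c' y) ^ 2) =
          ∑ x ∈ fib q i, ∑ y ∈ fib q j, (2 * adjR G x y *
            (if x ∈ A i j ∧ y ∈ B i j then density G (A i j) (B i j)
              else density G (fib q i) (fib q j)) -
            (if x ∈ A i j ∧ y ∈ B i j then density G (A i j) (B i j)
              else density G (fib q i) (fib q j)) ^ 2) := by
        refine Finset.sum_congr rfl fun x hx => Finset.sum_congr rfl fun y hy => ?_
        rw [mem_fib] at hx hy
        have : g' (c' x) (c' y) = (if x ∈ A i j ∧ y ∈ B i j then density G (A i j) (B i j)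
              else density G (fib q i) (fib q j)) := by
          simp only [g', c', hx, hy, if_pos hb, decide_eq_true_eq]
        rw [this]
      rw [e1, e2]
      linarith
    · rw [if_neg hb, add_zero]
      apply le_of_eq
      refine Finset.sum_congr rfl fun x hx => Finset.sum_congr rfl fun y hy => ?_
      rw [mem_fib] at hx hy
      have : g' (c' x) (c' y) = g (c x) (c y) := by
        simp only [g', c', hx, hy, if_neg hb]
      rw [this]
  have hsum := Finset.sum_le_sum fun i (_ : i ∈ (univ : Finset (Fin t))) =>
    Finset.sum_le_sum fun j (_ : j ∈ (univ : Finset (Fin t))) => hblock i j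
  simp only [Finset.sum_add_distrib] at hsum
  unfold energyJ at he ⊢
  rw [sum_blocks q] at he ⊢
  have hgain : ε ^ 5 / 16 * p ^ 2 * n ^ 2 ≤
      ∑ i : Fin t, ∑ j : Fin t, (if Bad i j then ε ^ 4 * p ^ 2 * n ^ 2 / (4 * t ^ 2) else 0) := by
    rw [← Finset.sum_product', Finset.univ_product_univ, ← Finset.sum_filter, Finset.sum_const,
      nsmul_eq_mul]
    calc ε ^ 5 / 16 * p ^ 2 * n ^ 2
        = (ε / 4 * (t : ℝ) ^ 2) * (ε ^ 4 * p ^ 2 * n ^ 2 / (4 * t ^ 2)) := by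
          field_simp; ring
      _ ≤ _ := mul_le_mul_of_nonneg_right hcount (by positivity)
  linarith

lemma energy_bound {V : Type} [Fintype V] (G : SimpleGraph V) (η p D : ℝ) (K : ℕ) (e : ℝ)
    (hD : 0 < D) (hp : 0 < p) (hη : η ≤ 1)
    (hG : UpperUniform' G η p D) (hS : EnergyState G (D * p) K e) :
    e ≤ 2 * D ^ 2 * p ^ 2 * (Fintype.card V : ℝ) ^ 2 := by
  obtain ⟨c, g, hg, he⟩ := hS
  have h1 := hG.2 univ (by
    rw [Finset.card_univ]
    exact mul_le_of_le_one_left (by positivity) hη)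
  rw [Finset.card_univ] at h1
  have h2 : (edgesBetween G univ univ : ℝ) = 2 * edgesWithin G univ := by
    exact_mod_cast edgesBetween_self G univ
  have h3 : (((Fintype.card V).choose 2 : ℕ) : ℝ) ≤ (Fintype.card V : ℝ) ^ 2 / 2 := by
    rw [Nat.cast_choose_two]
    nlinarith [(Nat.cast_nonneg (Fintype.card V) : (0 : ℝ) ≤ Fintype.card V)]
  have h4 : energyJ G (fun x y => g (c x) (c y)) ≤ 2 * (D * p) * edgesBetween G univ univ := by
    rw [edgesBetween_eq_sum]
    unfold energyJ
    simp only [Finset.mul_sum]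
    refine Finset.sum_le_sum fun x _ => Finset.sum_le_sum fun y _ => ?_
    have h5 : 0 ≤ adjR G x y := by unfold adjR; split_ifs <;> norm_num
    have h6 := mul_le_mul_of_nonneg_left (hg (c x) (c y)).2 h5
    nlinarith [sq_nonneg (g (c x) (c y))]
  have hDp : 0 < D * p := by positivity
  have h7 := mul_le_mul_of_nonneg_left h3 hDp.le
  calc e ≤ 2 * (D * p) * edgesBetween G univ univ := he.trans h4
    _ ≤ 2 * (D * p) * (D * p * (Fintype.card V : ℝ) ^ 2) := by
        apply mul_le_mul_of_nonneg_left _ (by positivity)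
        rw [h2]; linarith
    _ = _ := by ring

/-- Number of parts used for `K` colours. -/
noncomputable def tf (ε : ℝ) (t₀ K : ℕ) : ℕ := t₀ + ⌈8 * (K : ℝ) / ε⌉₊

/-- Sequence of colour numbers. -/
noncomputable def kseq (ε : ℝ) (t₀ : ℕ) : ℕ → ℕ
  | 0 => 1
  | k + 1 => kseq ε t₀ k * (tf ε t₀ (kseq ε t₀ k) *
      (2 ^ tf ε t₀ (kseq ε t₀ k) * 2 ^ tf ε t₀ (kseq ε t₀ k)))

lemma core (ε D : ℝ) (hε : 0 < ε) (hD : 0 < D) (t₀ : ℕ) (ht₀ : 0 < t₀) :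
    ∃ (η : ℝ) (T : ℕ), 0 < η ∧ t₀ ≤ T ∧ η * (2 * T) ≤ 1 ∧ η ≤ 1 ∧
      ∀ (p : ℝ), 0 < p → ∀ (V : Type) [Fintype V] (G : SimpleGraph V),
        T ≤ Fintype.card V → UpperUniform' G η p D →
        ∃ (t : ℕ) (q : V → Fin t), t₀ ≤ t ∧ t ≤ T ∧ BalLab q ∧
          ((irr G q ε p).card : ℝ) ≤ ε / 2 * (t : ℝ) ^ 2 := by
  obtain ⟨M, hM⟩ := exists_nat_gt (2 * D ^ 2 / (ε ^ 5 / 16))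
  rw [div_lt_iff₀ (by positivity)] at hM
  set T := ∑ k ∈ range (M + 1), tf ε t₀ (kseq ε t₀ k) with hT
  have hTk : ∀ k, k ≤ M → tf ε t₀ (kseq ε t₀ k) ≤ T := fun k hk =>
    Finset.single_le_sum (f := fun k => tf ε t₀ (kseq ε t₀ k)) (fun _ _ => Nat.zero_le _)
      (mem_range.mpr (by omega))
  have htf : ∀ K, t₀ ≤ tf ε t₀ K := fun K => Nat.le_add_right _ _
  have hTt : t₀ ≤ T := (htf _).trans (hTk 0 (Nat.zero_le _))
  have hTpos : (1 : ℝ) ≤ T := by exact_mod_cast ht₀.trans_le hTt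
  have hη0 : 0 < min ε 1 / (2 * T) := by positivity
  have hηT : min ε 1 / (2 * T) * (2 * T) = min ε 1 := by field_simp
  refine ⟨min ε 1 / (2 * T), T, hη0, hTt, ?_, ?_, ?_⟩
  · rw [hηT]; exact min_le_right _ _
  · have := min_le_right ε 1
    rw [div_le_iff₀ (by positivity)]
    linarith
  intro p hp V _ G hTn hG
  set η := min ε 1 / (2 * T) with hη
  by_contra hcon
  push Not at hcon
  have hne : Nonempty V := Fintype.card_pos_iff.mp (by omega)
  have hind : ∀ k, k ≤ M → EnergyState G (D * p) (kseq ε t₀ k)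
      (k * (ε ^ 5 / 16 * p ^ 2 * (Fintype.card V : ℝ) ^ 2)) := by
    intro k
    induction k with
    | zero =>
      intro _
      refine ⟨fun _ => ⟨0, by simp [kseq]⟩, fun _ _ => 0, fun _ _ => ⟨le_rfl, by positivity⟩, ?_⟩
      simp [energyJ]
    | succ k ih =>
      intro hk
      have h1 := ih (by omega)
      set t := tf ε t₀ (kseq ε t₀ k) with ht
      have htT : t ≤ T := hTk k (by omega)
      have htT' : (t : ℝ) ≤ T := by exact_mod_cast htT
      have hle : η * (2 * t) ≤ min ε 1 := by
        rw [← hηT]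
        exact mul_le_mul_of_nonneg_left (by linarith) hη0.le
      have hK : 8 * (kseq ε t₀ k : ℝ) ≤ ε * t := by
        have h2 := Nat.le_ceil (8 * (kseq ε t₀ k : ℝ) / ε)
        rw [div_le_iff₀ hε] at h2
        have h3 : (t : ℝ) = t₀ + ⌈8 * (kseq ε t₀ k : ℝ) / ε⌉₊ := by
          rw [ht, tf]; push_cast; rfl
        rw [h3]
        have : 0 ≤ ε * (t₀ : ℝ) := by positivity
        nlinarith
      rcases step G ε D p η (kseq ε t₀ k) t hε hD hp (ht₀.trans_le (htf _)) (htT.trans hTn)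
        (hle.trans (min_le_left _ _)) (hle.trans (min_le_right _ _)) hK hG.1 _ h1 with h | h
      · obtain ⟨q, hq, hq'⟩ := h
        exact absurd hq' (not_le.mpr (hcon t q (htf _) htT hq))
      · have e1 : ((k + 1 : ℕ) : ℝ) * (ε ^ 5 / 16 * p ^ 2 * (Fintype.card V : ℝ) ^ 2) =
            k * (ε ^ 5 / 16 * p ^ 2 * (Fintype.card V : ℝ) ^ 2) +
              ε ^ 5 / 16 * p ^ 2 * (Fintype.card V : ℝ) ^ 2 := by
          push_cast
          ring
        rw [e1]
        exact h
  have hη1 : η ≤ 1 := by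
    have := min_le_right ε 1
    rw [hη, div_le_iff₀ (by positivity)]
    linarith
  have hfin := energy_bound G η p D _ _ hD hp hη1 hG (hind M le_rfl)
  have hpos : 0 < p ^ 2 * (Fintype.card V : ℝ) ^ 2 := by
    have : (0 : ℝ) < Fintype.card V := by exact_mod_cast Fintype.card_pos
    positivity
  nlinarith

lemma BalLab.diff {V : Type} [Fintype V] {t : ℕ} {q : V → Fin t} (h : BalLab q) (i j : Fin t) :
    ((fib q i).card : ℤ) - ((fib q j).card : ℤ) ≤ 1 := by
  have h1 := h.1 i
  have h2 := h.2 j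
  have ht : (0 : ℤ) < t := by exact_mod_cast (Nat.zero_le _).trans_lt i.2
  have h3 : ((fib q i).card : ℤ) * t < (((fib q j).card : ℤ) + 2) * t := by linarith
  have := lt_of_mul_lt_mul_right h3 ht.le
  omega

lemma fib_disjoint {V : Type} [Fintype V] {t : ℕ} (q : V → Fin t) (i j : Fin t) (h : i ≠ j) :
    Disjoint (fib q i) (fib q j) := by
  rw [Finset.disjoint_left]
  intro v hv hv'
  rw [mem_fib] at hv hv'
  exact h (hv.symm.trans hv')

lemma edgesBetween_bot {V : Type} (X Y : Finset V) :
    edgesBetween (⊥ : SimpleGraph V) X Y = 0 := by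
  simp [edgesBetween]

lemma edgesBetween_blocks {V : Type} [Fintype V] {t : ℕ} (G : SimpleGraph V) (q : V → Fin t) :
    2 * (edgeCount G : ℝ) = ∑ i, ∑ j, (edgesBetween G (fib q i) (fib q j) : ℝ) := by
  have : 2 * (edgeCount G : ℝ) = edgesBetween G univ univ := by
    exact_mod_cast (edgesBetween_univ G).symm
  rw [this, edgesBetween_eq_sum, sum_blocks q]
  simp only [edgesBetween_eq_sum]

set_option maxHeartbeats 2000000 in
/-- Sparse regularity lemma with cleaning. -/
theorem sparse_regularity_with_cleaning (ε D : ℝ) (hε : 0 < ε) (hD : 0 < D)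
    (t₀ : ℕ) (ht₀ : 0 < t₀) :
    ∃ (η : ℝ) (T : ℕ), 0 < η ∧ 0 < T ∧
      ∀ (d : ℝ), 0 < d → ∀ (p : ℝ), 0 ≤ p → p ≤ 1 →
      ∀ (V : Type) [Fintype V], ∀ (G : SimpleGraph V),
        t₀ ≤ Fintype.card V → UpperUniform' G η p D →
        ∃ (G' : SimpleGraph V), G' ≤ G ∧
          (edgeCount G : ℝ) - (D / (t₀ : ℝ) + 2 * D * ε + d) * p * (Fintype.card V : ℝ) ^ 2 / 2
            ≤ (edgeCount G' : ℝ) ∧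
          ∃ (t : ℕ) (Q : Fin t → Finset V),
            t₀ ≤ t ∧ t ≤ T ∧
            (∀ i j, i ≠ j → Disjoint (Q i) (Q j)) ∧
            (∀ v, ∃ i, v ∈ Q i) ∧
            (∀ i j, ((Q i).card : ℤ) - ((Q j).card : ℤ) ≤ 1) ∧
            (∀ i, ∀ u ∈ Q i, ∀ v ∈ Q i, ¬ G'.Adj u v) ∧
            (∀ i j, i ≠ j → edgesBetween G' (Q i) (Q j) ≠ 0 →
              IsRegularPair G' (Q i) (Q j) ε p ∧
              d * p * ((Q i).card : ℝ) * ((Q j).card : ℝ)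
                ≤ (edgesBetween G' (Q i) (Q j) : ℝ)) := by
  obtain ⟨η, T, hη, hT, hηT, hη1, hcore⟩ := core ε D hε hD t₀ ht₀
  refine ⟨η, T, hη, ht₀.trans_le hT, ?_⟩
  intro d hd p hp0 hp1 V _ G hn hG
  have hne : Nonempty V := Fintype.card_pos_iff.mp (by omega)
  set n : ℝ := (Fintype.card V : ℝ) with hnR
  have hnpos : 0 < n := by rw [hnR]; exact_mod_cast Fintype.card_pos
  have ht₀R : (0 : ℝ) < t₀ := by exact_mod_cast ht₀
  have htot : 2 * (edgeCount G : ℝ) ≤ n ^ 2 := by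
    have h1 := edgesBetween_le G univ univ
    rw [edgesBetween_univ, Finset.card_univ] at h1
    rw [pow_two, hnR]
    exact_mod_cast h1
  -- trivial case
  by_cases htriv : (edgeCount G : ℝ) ≤ (D / (t₀ : ℝ) + 2 * D * ε + d) * p * n ^ 2 / 2
  · obtain ⟨q, h1, h2, -⟩ := exists_blocks 1 t₀ ht₀ (fun _ : V => 0)
    have hq : BalLab q := ⟨h1, h2⟩
    refine ⟨⊥, bot_le, ?_, t₀, fib q, le_rfl, hT, fib_disjoint q,
      fun v => ⟨q v, by rw [mem_fib]⟩, hq.diff, ?_, ?_⟩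
    · have : (0 : ℝ) ≤ edgeCount (⊥ : SimpleGraph V) := by positivity
      linarith
    · intro i u _ v _ h
      exact h
    · intro i j _ h
      exact absurd (edgesBetween_bot _ _) h
  push Not at htriv
  have hp : 0 < p := by
    rcases hp0.lt_or_eq with h | h
    · exact h
    · exfalso
      have h1 := hG.2 univ (by
        rw [Finset.card_univ]
        exact mul_le_of_le_one_left (by positivity) hη1)
      have h2 : (edgesBetween G univ univ : ℝ) = 2 * edgesWithin G univ := by
        exact_mod_cast edgesBetween_self G univ
      have h3 : (edgesBetween G univ univ : ℝ) = 2 * edgeCount G := by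
        exact_mod_cast edgesBetween_univ G
      rw [← h] at h1 htriv
      simp only [mul_zero, zero_mul, zero_div] at h1 htriv
      linarith
  by_cases hsmall : Fintype.card V < T
  · -- singletons
    have hdp : d * p ≤ 1 := by
      by_contra hc
      push Not at hc
      have h1 : 0 ≤ (D / (t₀ : ℝ) + 2 * D * ε) * p * n ^ 2 := by positivity
      have h2 : n ^ 2 ≤ d * p * n ^ 2 := le_mul_of_one_le_left (by positivity) hc.le
      nlinarith
    let e := Fintype.equivFin V
    refine ⟨G, le_rfl, ?_, Fintype.card V, fun i => {e.symm i}, hn, hsmall.le, ?_, ?_, ?_, ?_, ?_⟩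
    · have h1 : 0 ≤ (D / (t₀ : ℝ) + 2 * D * ε + d) * p * n ^ 2 / 2 := by positivity
      linarith
    · intro i j hij
      simpa using fun h => hij h
    · intro v
      exact ⟨e v, by simp⟩
    · intro i j
      simp
    · intro i u hu v hv h
      simp only [Finset.mem_singleton] at hu hv
      rw [hu, hv] at h
      exact G.loopless.irrefl _ h
    · intro i j _ hE
      constructor
      · intro A' hA B' hB h1 h2
        simp only [Finset.card_singleton, Nat.cast_one, mul_one] at h1 h2
        have hA' : A' = {e.symm i} := by
          rcases Finset.subset_singleton_iff.mp hA with h | h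
          · rw [h] at h1; simp at h1; linarith
          · exact h
        have hB' : B' = {e.symm j} := by
          rcases Finset.subset_singleton_iff.mp hB with h | h
          · rw [h] at h2; simp at h2; linarith
          · exact h
        rw [hA', hB', sub_self, abs_zero]
        positivity
      · have : (1 : ℝ) ≤ edgesBetween G {e.symm i} {e.symm j} := by
          exact_mod_cast Nat.one_le_iff_ne_zero.mpr hE
        simp only [Finset.card_singleton, Nat.cast_one, mul_one]
        linarith
  -- main case
  push Not at hsmall
  obtain ⟨t, q, htt, htT, hq, hirr⟩ := hcore p hp V G hsmall hG
  have ht : 0 < t := ht₀.trans_le htt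
  have htR : (0 : ℝ) < t := by exact_mod_cast ht
  have hlow := hq.lower ht (htT.trans hsmall)
  have hup := hq.upper ht (htT.trans hsmall)
  have hpart : ∀ i, η * n ≤ (fib q i).card := by
    intro i
    refine le_trans ?_ (hlow i)
    rw [le_div_iff₀ (by positivity)]
    have h1 : (t : ℝ) ≤ T := by exact_mod_cast htT
    have h2 : η * (2 * t) ≤ 1 := le_trans (mul_le_mul_of_nonneg_left (by linarith) hη.le) hηT
    nlinarith
  let Good : Fin t → Fin t → Prop := fun i j => i ≠ j ∧ (i, j) ∉ irr G q ε p ∧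
    d * p * ((fib q i).card : ℝ) * ((fib q j).card : ℝ) ≤ edgesBetween G (fib q i) (fib q j)
  have hirr_mem : ∀ i j, i ≠ j → ((i, j) ∉ irr G q ε p ↔
      IsRegularPair G (fib q i) (fib q j) ε p) := by
    intro i j hij
    simp [mem_irr, hij]
  have hGoodsymm : ∀ i j, Good i j → Good j i := by
    intro i j ⟨h1, h2, h3⟩
    refine ⟨h1.symm, ?_, ?_⟩
    · rw [hirr_mem _ _ h1.symm]
      exact ((hirr_mem _ _ h1).mp h2).symm'
    · rw [edgesBetween_comm]
      linarith
  obtain ⟨G', hG'⟩ : ∃ G' : SimpleGraph V, ∀ u v, G'.Adj u v ↔ G.Adj u v ∧ Good (q u) (q v) :=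
    ⟨{ Adj := fun u v => G.Adj u v ∧ Good (q u) (q v)
       symm := ⟨fun u v h => ⟨h.1.symm, hGoodsymm _ _ h.2⟩⟩
       loopless := ⟨fun u h => G.loopless.irrefl u h.1⟩ }, fun u v => Iff.rfl⟩
  have hE : ∀ i j, ∀ A ⊆ fib q i, ∀ B ⊆ fib q j, Good i j →
      edgesBetween G' A B = edgesBetween G A B := by
    intro i j A hA B hB hg
    unfold edgesBetween
    congr 1
    ext ⟨x, y⟩
    rw [Finset.mem_filter, Finset.mem_filter]
    refine and_congr_right fun hxy => ?_
    rw [Finset.mem_product] at hxy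
    have h1 := (mem_fib q i x).mp (hA hxy.1)
    have h2 := (mem_fib q j y).mp (hB hxy.2)
    rw [hG', h1, h2]
    exact and_iff_left hg
  have hgood_of : ∀ i j, edgesBetween G' (fib q i) (fib q j) ≠ 0 → Good i j := by
    intro i j h
    unfold edgesBetween at h
    obtain ⟨⟨x, y⟩, hxy⟩ := Finset.card_ne_zero.mp h
    simp only [Finset.mem_filter, Finset.mem_product, mem_fib] at hxy
    obtain ⟨⟨rfl, rfl⟩, h2⟩ := hxy
    exact ((hG' _ _).mp h2).2
  refine ⟨G', fun u v h => ((hG' u v).mp h).1, ?_, t, fib q, htt, htT, fib_disjoint q,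
      fun v => ⟨q v, by rw [mem_fib]⟩, hq.diff, ?_, ?_⟩
  · -- edge count
    have hpair : ∀ i j, (edgesBetween G (fib q i) (fib q j) : ℝ) ≤
        edgesBetween G' (fib q i) (fib q j) +
        (if i = j then D * p * (n / t) * (fib q i).card else 0) +
        (if (i, j) ∈ irr G q ε p then D * p * (4 * n ^ 2 / t ^ 2) else 0) +
        d * p * ((fib q i).card * (fib q j).card) := by
      intro i j
      have z0 : (0 : ℝ) ≤ edgesBetween G' (fib q i) (fib q j) := by positivity
      have z1 : 0 ≤ (if i = j then D * p * (n / t) * (fib q i).card else 0 : ℝ) := by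
        split_ifs <;> positivity
      have z2 : 0 ≤ (if (i, j) ∈ irr G q ε p then D * p * (4 * n ^ 2 / t ^ 2) else 0 : ℝ) := by
        split_ifs <;> positivity
      have z3 : 0 ≤ d * p * ((fib q i).card * (fib q j).card : ℝ) := by positivity
      by_cases hg : Good i j
      · have h1 := hE i j _ subset_rfl _ subset_rfl hg
        rw [h1] at z0 ⊢
        linarith
      by_cases hij : i = j
      · subst hij
        have h1 := hG.2 (fib q i) (hpart i)
        have h2 : (edgesBetween G (fib q i) (fib q i) : ℝ) = 2 * edgesWithin G (fib q i) := by
          exact_mod_cast edgesBetween_self G (fib q i)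
        rw [Nat.cast_choose_two] at h1
        have h3 : ((fib q i).card : ℝ) - 1 ≤ n / t := by
          rw [le_div_iff₀ htR]
          have h4 := hq.1 i
          have h5 : ((fib q i).card : ℝ) * t < n + t := by rw [hnR]; exact_mod_cast h4
          linarith
        have h6 : D * p * (fib q i).card * (((fib q i).card : ℝ) - 1) ≤
            D * p * (fib q i).card * (n / t) := mul_le_mul_of_nonneg_left h3 (by positivity)
        rw [if_pos rfl] at z1 ⊢
        nlinarith
      by_cases hir : (i, j) ∈ irr G q ε p
      · have h1 := hG.1 _ _ (fib_disjoint q i j hij) (hpart i) (hpart j)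
        have h2 := density_mul G (fib q i) (fib q j)
        have h3 : (edgesBetween G (fib q i) (fib q j) : ℝ) ≤ D * p * (4 * n ^ 2 / t ^ 2) := by
          rw [← h2]
          calc density G (fib q i) (fib q j) * ((fib q i).card * (fib q j).card : ℝ)
              ≤ (D * p) * ((2 * n / t) * (2 * n / t)) := by
                apply mul_le_mul h1 _ (mul_nonneg (Nat.cast_nonneg _) (Nat.cast_nonneg _)) (by positivity)
                exact mul_le_mul (hup i) (hup j) (Nat.cast_nonneg _) (by positivity)
            _ = _ := by field_simp; ring
        rw [if_pos hir]
        linarith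
      · have h1 : (edgesBetween G (fib q i) (fib q j) : ℝ) <
            d * p * ((fib q i).card : ℝ) * ((fib q j).card : ℝ) := by
          by_contra hc
          push Not at hc
          exact hg ⟨hij, hir, hc⟩
        linarith
    have hsum := Finset.sum_le_sum fun i (_ : i ∈ (univ : Finset (Fin t))) =>
      Finset.sum_le_sum fun j (_ : j ∈ (univ : Finset (Fin t))) => hpair i j
    simp only [Finset.sum_add_distrib] at hsum
    rw [← edgesBetween_blocks, ← edgesBetween_blocks] at hsum
    have hcard : ∑ i, ((fib q i).card : ℝ) = n := by
      have h1 := Finset.card_eq_sum_card_fiberwise (f := q) (s := univ) (t := univ)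
        (fun _ _ => Finset.mem_coe.mpr (mem_univ _))
      rw [hnR, ← Finset.card_univ, h1]
      push_cast
      rfl
    have s1 : ∑ i : Fin t, ∑ j : Fin t, (if i = j then D * p * (n / t) * (fib q i).card else 0 : ℝ)
        ≤ D / t₀ * p * n ^ 2 := by
      simp only [Finset.sum_ite_eq, Finset.mem_univ, if_true]
      rw [← Finset.mul_sum, hcard]
      have h1 : n / t ≤ n / t₀ := div_le_div_of_nonneg_left hnpos.le ht₀R (by exact_mod_cast htt)
      calc D * p * (n / t) * n ≤ D * p * (n / t₀) * n := by gcongr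
        _ = _ := by ring
    have s2 : ∑ i : Fin t, ∑ j : Fin t,
        (if (i, j) ∈ irr G q ε p then D * p * (4 * n ^ 2 / t ^ 2) else 0 : ℝ)
        ≤ 2 * D * ε * p * n ^ 2 := by
      rw [← Finset.sum_product' (f := fun i j =>
        (if (i, j) ∈ irr G q ε p then D * p * (4 * n ^ 2 / t ^ 2) else 0 : ℝ)),
        Finset.univ_product_univ]
      simp only [Prod.mk.eta]
      rw [← Finset.sum_filter, Finset.sum_const, nsmul_eq_mul, Finset.filter_mem_eq_inter,
        Finset.univ_inter]
      calc ((irr G q ε p).card : ℝ) * (D * p * (4 * n ^ 2 / t ^ 2))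
          ≤ (ε / 2 * (t : ℝ) ^ 2) * (D * p * (4 * n ^ 2 / t ^ 2)) :=
            mul_le_mul_of_nonneg_right hirr (by positivity)
        _ = _ := by field_simp; ring
    have s3 : ∑ i : Fin t, ∑ j : Fin t, d * p * ((fib q i).card * (fib q j).card : ℝ)
        = d * p * n ^ 2 := by
      simp only [← Finset.mul_sum]
      rw [← Finset.sum_mul, hcard]
      ring
    rw [s3] at hsum
    nlinarith
  · intro i u hu v hv h
    rw [mem_fib] at hu hv
    exact ((hG' u v).mp h).2.1 (hu.trans hv.symm)
  · intro i j hij hne0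
    have hg := hgood_of i j hne0
    constructor
    · intro A hA B hB h1 h2
      unfold density
      rw [hE i j A hA B hB hg, hE i j _ subset_rfl _ subset_rfl hg]
      exact (hirr_mem i j hij).mp hg.2.1 A hA B hB h1 h2
    · rw [hE i j _ subset_rfl _ subset_rfl hg]
      exact hg.2.2
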